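/- arXiv:1409.3430 — 4 statements merged into one kernel-verified Lean document; each statement's English description precedes it below -/
import Mathlib

section
/- Let q ≥ 1 be an integer and let M : C_{q,Lip}(ℝ^n) → ℝ be a linear functional such that M is monotone (M[f] ≤ M[g] whenever f ≤ g pointwise), M[1] = 1, and M[f_i] → 0 for every sequence (f_i) in C_{q,Lip}(ℝ^n) decreasing pointwise to 0. Then there exists a unique Borel probability measure m on ℝ^n such that every f ∈ C_{q,Lip}(ℝ^n) is m-integrable and M[f] = ∫_{ℝ^n} f(x) m(dx) for all f ∈ C_{q,Lip}(ℝ^n). -/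
open MeasureTheory Filter Topology

/-- The space `C_{q,Lip}(ℝ^n)` of locally Lipschitz functions with polynomial growth of
order `q`. -/
def CLip (q n : ℕ) : Set ((EuclideanSpace ℝ (Fin n)) → ℝ) :=
  {f | ∃ K : ℝ, ∀ x x' : EuclideanSpace ℝ (Fin n),
    |f x - f x'| ≤ K * (1 + ‖x‖ ^ (q - 1) + ‖x'‖ ^ (q - 1)) * ‖x - x'‖}

open scoped CompactlySupported NNReal ENNReal

namespace CLip

variable {n q : ℕ} {f g : EuclideanSpace ℝ (Fin n) → ℝ}

theorem exists_nonneg_bound (hf : f ∈ CLip q n) :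
    ∃ K : ℝ, 0 ≤ K ∧ ∀ x x' : EuclideanSpace ℝ (Fin n),
      |f x - f x'| ≤ K * (1 + ‖x‖ ^ (q - 1) + ‖x'‖ ^ (q - 1)) * ‖x - x'‖ := by
  obtain ⟨K, hK⟩ := hf
  refine ⟨|K|, abs_nonneg K, fun x x' => (hK x x').trans ?_⟩
  gcongr
  exact le_abs_self K

theorem continuous (hf : f ∈ CLip q n) : Continuous f := by
  obtain ⟨K, hK⟩ := hf
  refine continuous_iff_continuousAt.2 fun a => tendsto_iff_norm_sub_tendsto_zero.2 ?_
  have hlim : Tendsto (fun x => K * (1 + ‖x‖ ^ (q - 1) + ‖a‖ ^ (q - 1)) * ‖x - a‖)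
      (𝓝 a) (𝓝 (K * (1 + ‖a‖ ^ (q - 1) + ‖a‖ ^ (q - 1)) * ‖a - a‖)) :=
    Continuous.tendsto (by fun_prop) a
  rw [sub_self, norm_zero, mul_zero] at hlim
  exact squeeze_zero (fun _ => norm_nonneg _) (fun x => hK x a) hlim

theorem of_lipschitzWith {C : ℝ≥0} (hf : LipschitzWith C f) : f ∈ CLip q n := by
  refine ⟨C, fun x x' => ?_⟩
  have h := hf.dist_le_mul x x'
  rw [Real.dist_eq, dist_eq_norm] at h
  refine h.trans ?_
  gcongr
  have h₁ : 0 ≤ ‖x‖ ^ (q - 1) := by positivity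
  have h₂ : 0 ≤ ‖x'‖ ^ (q - 1) := by positivity
  exact le_mul_of_one_le_right C.2 (by linarith)

theorem const (c : ℝ) : (fun _ => c) ∈ CLip q n :=
  of_lipschitzWith (LipschitzWith.const c)

theorem add (hf : f ∈ CLip q n) (hg : g ∈ CLip q n) : f + g ∈ CLip q n := by
  obtain ⟨K, hK⟩ := hf
  obtain ⟨L, hL⟩ := hg
  refine ⟨K + L, fun x x' => ?_⟩
  calc |f x + g x - (f x' + g x')| = |(f x - f x') + (g x - g x')| := by ring_nf
    _ ≤ |f x - f x'| + |g x - g x'| := abs_add_le _ _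
    _ ≤ _ := by linarith [hK x x', hL x x']

theorem smul (a : ℝ) (hf : f ∈ CLip q n) : a • f ∈ CLip q n := by
  obtain ⟨K, hK⟩ := hf
  refine ⟨|a| * K, fun x x' => ?_⟩
  calc |a * f x - a * f x'| = |a| * |f x - f x'| := by rw [← mul_sub, abs_mul]
    _ ≤ |a| * (K * (1 + ‖x‖ ^ (q - 1) + ‖x'‖ ^ (q - 1)) * ‖x - x'‖) := by gcongr; exact hK x x'
    _ = _ := by ring

theorem inf (hf : f ∈ CLip q n) (hg : g ∈ CLip q n) : f ⊓ g ∈ CLip q n := by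
  obtain ⟨K, hK₀, hK⟩ := exists_nonneg_bound hf
  obtain ⟨L, hL₀, hL⟩ := exists_nonneg_bound hg
  refine ⟨K + L, fun x x' => (abs_min_sub_min_le_max _ _ _ _).trans (max_le ?_ ?_)⟩
  · refine (hK x x').trans ?_
    gcongr
    linarith
  · refine (hL x x').trans ?_
    gcongr
    linarith

end CLip

/-- The function `x ↦ (r - ‖x‖)⁺`. -/
noncomputable def tent (n : ℕ) (r : ℝ) (x : EuclideanSpace ℝ (Fin n)) : ℝ :=
  max (r - ‖x‖) 0

theorem lipschitzWith_tent (n : ℕ) (r : ℝ) : LipschitzWith 1 (tent n r) := by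
  refine LipschitzWith.of_dist_le_mul fun x y => ?_
  rw [Real.dist_eq, dist_eq_norm, NNReal.coe_one, one_mul]
  refine (abs_max_sub_max_le_abs _ _ _).trans ?_
  rw [sub_sub_sub_cancel_left, abs_sub_comm]
  exact abs_norm_sub_norm_le x y

theorem tent_mem_CLip (q n : ℕ) (r : ℝ) : tent n r ∈ CLip q n :=
  CLip.of_lipschitzWith (lipschitzWith_tent n r)

theorem tent_nonneg {n : ℕ} (r : ℝ) (x : EuclideanSpace ℝ (Fin n)) : 0 ≤ tent n r x :=
  le_max_right _ _

theorem tent_mono {n : ℕ} (x : EuclideanSpace ℝ (Fin n)) : Monotone fun r => tent n r x :=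
  fun _ _ h => max_le_max_right _ (sub_le_sub_right h _)

theorem tent_eq_zero {n : ℕ} {r : ℝ} {x : EuclideanSpace ℝ (Fin n)} (h : r ≤ ‖x‖) :
    tent n r x = 0 :=
  max_eq_right (sub_nonpos.2 h)

theorem hasCompactSupport_of_abs_le_tent {n : ℕ} {r : ℝ} {f : EuclideanSpace ℝ (Fin n) → ℝ}
    (h : ∀ x, |f x| ≤ tent n r x) : HasCompactSupport f := by
  refine HasCompactSupport.intro (isCompact_closedBall 0 r) fun x hx => ?_
  rw [mem_closedBall_zero_iff, not_le] at hx
  exact abs_nonpos_iff.1 ((h x).trans_eq (tent_eq_zero hx.le))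

/-- A compactly supported continuous function is dominated by a tent. -/
theorem exists_abs_le_tent {n : ℕ} (f : C_c(EuclideanSpace ℝ (Fin n), ℝ)) :
    ∃ r, ∀ x, |f x| ≤ tent n r x := by
  obtain ⟨C, hC⟩ := f.hasCompactSupport.exists_bound_of_continuous f.continuous
  obtain ⟨R, hR⟩ := f.hasCompactSupport.isCompact.isBounded.exists_norm_le
  refine ⟨R + C, fun x => ?_⟩
  by_cases hx : x ∈ tsupport f
  · refine le_max_of_le_left ?_
    have h₁ : |f x| ≤ C := hC x
    linarith [hR x hx]
  · rw [image_eq_zero_of_notMem_tsupport hx, abs_zero]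
    exact tent_nonneg _ _

/-- A functional on `CLip q n` that is linear and monotone on `CLip q n` is given by integration
against a Borel measure on the compactly supported elements of `CLip q n`. -/
theorem exists_measure_of_hasCompactSupport {n q : ℕ} {M : (EuclideanSpace ℝ (Fin n) → ℝ) → ℝ}
    (hadd : ∀ f ∈ CLip q n, ∀ g ∈ CLip q n, M (f + g) = M f + M g)
    (hsmul : ∀ f ∈ CLip q n, ∀ a : ℝ, M (a • f) = a * M f)
    (hmono : ∀ f ∈ CLip q n, ∀ g ∈ CLip q n, (∀ x, f x ≤ g x) → M f ≤ M g) :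
    ∃ m : Measure (EuclideanSpace ℝ (Fin n)), IsFiniteMeasureOnCompacts m ∧
      ∀ f ∈ CLip q n, HasCompactSupport f → ∫ x, f x ∂m = M f := by
  have hzero : M 0 = 0 := by
    have := hsmul _ (CLip.const 0) 0
    rwa [zero_smul, zero_mul] at this
  let s : PointedCone ℝ C_c(EuclideanSpace ℝ (Fin n), ℝ) :=
    { carrier := {f | ∀ x, 0 ≤ f x}
      zero_mem' := fun _ => le_rfl
      add_mem' := fun hf hg x => add_nonneg (hf x) (hg x)
      smul_mem' := fun c _ hf x => mul_nonneg c.2 (hf x) }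
  let p : C_c(EuclideanSpace ℝ (Fin n), ℝ) →ₗ.[ℝ] ℝ :=
    { domain :=
        { carrier := {f | ⇑f ∈ CLip q n}
          zero_mem' := CLip.const 0
          add_mem' := fun hf hg => CLip.add hf hg
          smul_mem' := fun a _ hf => CLip.smul a hf }
      toFun :=
        { toFun := fun f => M f.1
          map_add' := fun f g => hadd _ f.2 _ g.2
          map_smul' := fun a f => hsmul _ f.2 a } }
  obtain ⟨Λ, hΛ, hΛ₀⟩ := riesz_extension s p
    (fun f hf => hzero.symm.le.trans (hmono _ (CLip.const 0) _ f.2 hf))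
    (fun f => by
      obtain ⟨r, hr⟩ := exists_abs_le_tent f
      have htent : HasCompactSupport (tent n r) :=
        hasCompactSupport_of_abs_le_tent fun x => (abs_of_nonneg (tent_nonneg r x)).le
      refine ⟨⟨⟨⟨tent n r, (lipschitzWith_tent n r).continuous⟩, htent⟩, tent_mem_CLip q n r⟩,
        fun x => ?_⟩
      exact neg_le_iff_add_nonneg.1 ((neg_le_abs (f x)).trans (hr x)))
  refine ⟨RealRMK.rieszMeasure (PositiveLinearMap.mk₀ Λ hΛ₀), inferInstance, fun f hf hfc => ?_⟩
  let F : C_c(EuclideanSpace ℝ (Fin n), ℝ) := ⟨⟨f, CLip.continuous hf⟩, hfc⟩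
  exact (RealRMK.integral_rieszMeasure (PositiveLinearMap.mk₀ Λ hΛ₀) F).trans (hΛ ⟨F, hf⟩)

/-- If a nonnegative function is the pointwise limit of an increasing sequence of nonnegative
integrable functions whose integrals converge, then it is integrable and its integral is the
limit. -/
theorem integrable_and_integral_eq_of_monotone {α : Type*} [MeasurableSpace α] {μ : Measure α}
    {f : ℕ → α → ℝ} {F : α → ℝ} {c : ℝ} (hf : ∀ k, Integrable (f k) μ) (hf₀ : ∀ k x, 0 ≤ f k x)
    (hF₀ : ∀ x, 0 ≤ F x) (hFm : AEStronglyMeasurable F μ)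
    (hmono : ∀ x, Monotone fun k => f k x)
    (hlim : ∀ x, Tendsto (fun k => f k x) atTop (𝓝 (F x)))
    (hint : Tendsto (fun k => ∫ x, f k x ∂μ) atTop (𝓝 c)) :
    Integrable F μ ∧ ∫ x, F x ∂μ = c := by
  have h := lintegral_tendsto_of_tendsto_of_monotone
    (fun k => (hf k).aestronglyMeasurable.aemeasurable.ennreal_ofReal)
    (ae_of_all μ fun x _ _ hij => ENNReal.ofReal_le_ofReal (hmono x hij))
    (ae_of_all μ fun x => (ENNReal.continuous_ofReal.tendsto _).comp (hlim x))
  simp only [fun k => (ofReal_integral_eq_lintegral_ofReal (hf k) (ae_of_all μ (hf₀ k))).symm] at h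
  have hF : ∫⁻ x, ENNReal.ofReal (F x) ∂μ = ENNReal.ofReal c :=
    tendsto_nhds_unique h ((ENNReal.continuous_ofReal.tendsto _).comp hint)
  have hFi : Integrable F μ :=
    (lintegral_ofReal_ne_top_iff_integrable hFm (ae_of_all μ hF₀)).1
      (hF ▸ ENNReal.ofReal_ne_top)
  exact ⟨hFi, tendsto_nhds_unique
    (integral_tendsto_of_tendsto_of_monotone hf hFi (ae_of_all μ hmono) (ae_of_all μ hlim)) hint⟩

/-- Finite Borel measures that agree on Lipschitz functions with values in
`[0, 1]` are equal. -/
theorem measure_eq_of_forall_integral_lipschitzWith_eq {α : Type*} [PseudoEMetricSpace α]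
    [MeasurableSpace α] [BorelSpace α] {μ ν : Measure α} [IsFiniteMeasure μ] [IsFiniteMeasure ν]
    (h : ∀ (C : ℝ≥0) (f : α → ℝ), LipschitzWith C f → (∀ x, f x ∈ Set.Icc 0 1) →
      ∫ x, f x ∂μ = ∫ x, f x ∂ν) : μ = ν := by
  have key : ∀ F : Set α, IsClosed F → μ F = ν F := by
    intro F hF
    have hδ : ∀ k : ℕ, 0 < 1 / ((k : ℝ) + 1) := fun k => by positivity
    have hμ := tendsto_integral_thickenedIndicator_of_isClosed μ hF hδ
      tendsto_one_div_add_atTop_nhds_zero_nat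
    have hν := tendsto_integral_thickenedIndicator_of_isClosed ν hF hδ
      tendsto_one_div_add_atTop_nhds_zero_nat
    rw [← measureReal_eq_measureReal_iff]
    refine tendsto_nhds_unique hμ (hν.congr fun k => (h _ _
      (lipschitzWith_thickenedIndicator (hδ k) F) fun x => ⟨NNReal.coe_nonneg _, ?_⟩).symm)
    exact_mod_cast thickenedIndicator_le_one (hδ k) F x
  refine ext_of_generate_finite _ ?_ isPiSystem_isClosed key (key _ isClosed_univ)
  rw [BorelSpace.measurable_eq (α := α), borel_eq_generateFrom_isClosed]

/-- Daniell–Stone representation of a monotone, normalized, continuous-from-above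
linear functional on `C_{q,Lip}(ℝ^n)` by a unique Borel probability measure. -/
theorem daniell_stone_representation_CLip
    (n q : ℕ) (hq : 1 ≤ q)
    (M : ((EuclideanSpace ℝ (Fin n)) → ℝ) → ℝ)
    (hadd : ∀ f ∈ CLip q n, ∀ g ∈ CLip q n, M (f + g) = M f + M g)
    (hsmul : ∀ f ∈ CLip q n, ∀ a : ℝ, M (a • f) = a * M f)
    (hmono : ∀ f ∈ CLip q n, ∀ g ∈ CLip q n, (∀ x, f x ≤ g x) → M f ≤ M g)
    (hone : M (fun _ => 1) = 1)
    (hcont : ∀ f : ℕ → ((EuclideanSpace ℝ (Fin n)) → ℝ),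
      (∀ i, f i ∈ CLip q n) →
      (∀ x, Antitone (fun i => f i x)) →
      (∀ x, Tendsto (fun i => f i x) atTop (𝓝 0)) →
      Tendsto (fun i => M (f i)) atTop (𝓝 0)) :
    ∃ m : Measure (EuclideanSpace ℝ (Fin n)), IsProbabilityMeasure m ∧
      (∀ f ∈ CLip q n, Integrable f m ∧ ∫ x, f x ∂m = M f) ∧
      (∀ m' : Measure (EuclideanSpace ℝ (Fin n)), IsProbabilityMeasure m' →
        (∀ f ∈ CLip q n, Integrable f m' ∧ ∫ x, f x ∂m' = M f) → m' = m) := by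
  obtain ⟨m, hm, hmM⟩ := exists_measure_of_hasCompactSupport hadd hsmul hmono
  have hnonneg : ∀ f ∈ CLip q n, (∀ x, 0 ≤ f x) → Integrable f m ∧ ∫ x, f x ∂m = M f := by
    intro f hf hf₀
    let φ : ℕ → EuclideanSpace ℝ (Fin n) → ℝ := fun k => f ⊓ tent n k
    have hφ : ∀ k, φ k ∈ CLip q n := fun k => CLip.inf hf (tent_mem_CLip q n k)
    have hφ₀ : ∀ k x, 0 ≤ φ k x := fun k x => le_min (hf₀ x) (tent_nonneg _ x)
    have hφc : ∀ k, HasCompactSupport (φ k) := fun k =>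
      hasCompactSupport_of_abs_le_tent fun x =>
        (abs_of_nonneg (hφ₀ k x)).trans_le (min_le_right _ _)
    have hφmono : ∀ x, Monotone fun k => φ k x := fun x i j hij =>
      min_le_min_left _ (tent_mono x (Nat.cast_le.2 hij))
    have hφlim : ∀ x, Tendsto (fun k => φ k x) atTop (𝓝 (f x)) := by
      intro x
      refine tendsto_const_nhds.congr' ?_
      filter_upwards [tendsto_natCast_atTop_atTop.eventually_ge_atTop (f x + ‖x‖)] with k hk
      exact (min_eq_left (le_max_of_le_left (le_sub_iff_add_le.2 hk))).symm
    have hrem : ∀ k, f + (-1 : ℝ) • φ k ∈ CLip q n := fun k => CLip.add hf (CLip.smul _ (hφ k))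
    have hM := hcont _ hrem
      (fun x i j hij => add_le_add_right
        (mul_le_mul_of_nonpos_left (hφmono x hij) (neg_nonpos.2 zero_le_one)) (f x))
      (fun x => by simpa [← sub_eq_add_neg] using (hφlim x).const_sub (f x))
    have hMφ : Tendsto (fun k => M (φ k)) atTop (𝓝 (M f)) := by
      have h := hM.const_sub (M f)
      simp only [fun k => hadd _ hf _ (CLip.smul (-1) (hφ k)), fun k => hsmul _ (hφ k)] at h
      simpa using h
    refine integrable_and_integral_eq_of_monotone
      (fun k => (CLip.continuous (hφ k)).integrable_of_hasCompactSupport (hφc k)) hφ₀ hf₀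
      (CLip.continuous hf).aestronglyMeasurable hφmono hφlim ?_
    simpa only [fun k => hmM _ (hφ k) (hφc k)] using hMφ
  have hrep : ∀ f ∈ CLip q n, Integrable f m ∧ ∫ x, f x ∂m = M f := by
    intro f hf
    have hneg : (-1 : ℝ) • (f ⊓ fun _ => 0) ∈ CLip q n := CLip.smul _ (CLip.inf hf (CLip.const 0))
    have hpos : f + (-1 : ℝ) • (f ⊓ fun _ => 0) ∈ CLip q n := CLip.add hf hneg
    obtain ⟨hi, he⟩ := hnonneg _ hneg fun x => by simp
    obtain ⟨hi', he'⟩ := hnonneg _ hpos fun x => by simp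
    have hfi : Integrable f m := by simpa using hi'.sub hi
    refine ⟨hfi, ?_⟩
    rw [hadd _ hf _ hneg, ← he] at he'
    exact add_right_cancel ((integral_add hfi hi).symm.trans he')
  have hprob : IsProbabilityMeasure m := by
    obtain ⟨hi, he⟩ := hrep _ (CLip.const 1)
    have : IsFiniteMeasure m := (integrable_const_iff_isFiniteMeasure one_ne_zero).1 hi
    rw [hone, integral_const, smul_eq_mul, mul_one] at he
    exact ⟨by rwa [measureReal_def, ENNReal.toReal_eq_one_iff] at he⟩
  refine ⟨m, hprob, hrep, fun m' hm' hrep' => ?_⟩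
  refine measure_eq_of_forall_integral_lipschitzWith_eq fun C f hf _ => ?_
  rw [(hrep' f (CLip.of_lipschitzWith hf)).2, (hrep f (CLip.of_lipschitzWith hf)).2]
end

section
/- Let p ≥ 1 be an integer and let Λ : C_{2p,Lip}(ℝ^n) → ℝ be a sublinear expectation. Then there exists a nonempty family {m_θ}_{θ∈Θ} of Borel probability measures on ℝ^n such that every f ∈ C_{2p−1,Lip}(ℝ^n) is m_θ-integrable for each θ ∈ Θ and Λ[f] = sup_{θ∈Θ} ∫_{ℝ^n} f(x) m_θ(dx) for all f ∈ C_{2p−1,Lip}(ℝ^n). -/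
open MeasureTheory

open Filter Topology
open scoped CompactlySupported

section Growth

variable {X : Type*} [NormedAddCommGroup X]

/-- Functions of polynomial growth of order at most `q`. -/
def growthSubmodule (X : Type*) [NormedAddCommGroup X] (q : ℕ) : Submodule ℝ (X → ℝ) where
  carrier := {f | ∃ C : ℝ, ∀ x, |f x| ≤ C * (1 + ‖x‖) ^ q}
  zero_mem' := ⟨0, fun x => by simp⟩
  add_mem' := by
    rintro f g ⟨C, hC⟩ ⟨D, hD⟩
    refine ⟨C + D, fun x => ?_⟩
    rw [add_mul]
    exact (abs_add_le _ _).trans (add_le_add (hC x) (hD x))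
  smul_mem' := by
    rintro c f ⟨C, hC⟩
    refine ⟨|c| * C, fun x => ?_⟩
    rw [Pi.smul_apply, smul_eq_mul, abs_mul, mul_assoc]
    exact mul_le_mul_of_nonneg_left (hC x) (abs_nonneg c)

lemma mem_growthSubmodule_of_abs_le {q : ℕ} {f g : X → ℝ} (hg : g ∈ growthSubmodule X q)
    (h : ∀ x, |f x| ≤ |g x|) : f ∈ growthSubmodule X q := by
  obtain ⟨C, hC⟩ := hg
  exact ⟨C, fun x => (h x).trans (hC x)⟩

lemma one_add_norm_pow_mem_growthSubmodule (q : ℕ) :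
    (fun x : X => (1 + ‖x‖) ^ q) ∈ growthSubmodule X q :=
  ⟨1, fun x => by rw [one_mul, abs_of_nonneg (by positivity)]⟩

lemma mem_growthSubmodule_of_bounded {q : ℕ} {f : X → ℝ} {C : ℝ} (h : ∀ x, |f x| ≤ C) :
    f ∈ growthSubmodule X q := by
  refine ⟨C, fun x => (h x).trans ?_⟩
  have h1 : (1 : ℝ) ≤ (1 + ‖x‖) ^ q := one_le_pow₀ (by linarith [norm_nonneg x])
  nlinarith [(abs_nonneg _).trans (h x)]

/-- The continuous cutoff equal to `1` on the ball of radius `k + 1` and vanishing outside the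
ball of radius `2 * (k + 1)`. -/
noncomputable def radialCutoff (k : ℕ) (x : X) : ℝ := max 0 (min 1 (2 - ‖x‖ / (k + 1)))

lemma continuous_radialCutoff (k : ℕ) : Continuous (radialCutoff k : X → ℝ) := by
  unfold radialCutoff
  fun_prop

lemma radialCutoff_nonneg (k : ℕ) (x : X) : 0 ≤ radialCutoff k x := le_max_left _ _

lemma radialCutoff_le_one (k : ℕ) (x : X) : radialCutoff k x ≤ 1 :=
  max_le zero_le_one (min_le_left _ _)

lemma radialCutoff_eq_one {k : ℕ} {x : X} (h : ‖x‖ ≤ k + 1) : radialCutoff k x = 1 := by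
  have h1 : ‖x‖ / ((k : ℝ) + 1) ≤ 1 := (div_le_one (by positivity)).2 h
  rw [radialCutoff, min_eq_left (by linarith), max_eq_right zero_le_one]

lemma hasCompactSupport_radialCutoff [ProperSpace X] (k : ℕ) :
    HasCompactSupport (radialCutoff k : X → ℝ) := by
  refine HasCompactSupport.intro (isCompact_closedBall (0 : X) (2 * (k + 1))) fun x hx => ?_
  have hx' : 2 * ((k : ℝ) + 1) < ‖x‖ := by simpa using hx
  have h1 : 2 ≤ ‖x‖ / ((k : ℝ) + 1) := (le_div_iff₀ (by positivity)).2 hx'.le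
  exact max_eq_left ((min_le_right _ _).trans (by linarith))

lemma tendsto_mul_radialCutoff (f : X → ℝ) (x : X) :
    Tendsto (fun k : ℕ => f x * radialCutoff k x) atTop (𝓝 (f x)) := by
  refine tendsto_const_nhds.congr' ?_
  filter_upwards [eventually_ge_atTop ⌈‖x‖⌉₊] with k hk
  have h : ‖x‖ ≤ (k : ℝ) := (Nat.le_ceil _).trans (by exact_mod_cast hk)
  rw [radialCutoff_eq_one (by linarith), mul_one]

lemma abs_mul_radialCutoff_le (f : X → ℝ) (k : ℕ) (x : X) :
    |f x * radialCutoff k x| ≤ |f x| := by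
  rw [abs_mul, abs_of_nonneg (radialCutoff_nonneg k x)]
  exact mul_le_of_le_one_right (abs_nonneg _) (radialCutoff_le_one k x)

lemma abs_sub_mul_radialCutoff_le {f : X → ℝ} {C : ℝ} {q : ℕ}
    (hf : ∀ x, |f x| ≤ C * (1 + ‖x‖) ^ q) (k : ℕ) (x : X) :
    |f x - f x * radialCutoff k x| ≤ C / (k + 1) * (1 + ‖x‖) ^ (q + 1) := by
  have hk : (0 : ℝ) < k + 1 := by positivity
  have hC : 0 ≤ C := by
    have := (abs_nonneg _).trans (hf 0)
    simpa using this
  rcases le_or_gt ‖x‖ (k + 1) with h | h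
  · rw [radialCutoff_eq_one h]
    simp only [mul_one, sub_self, abs_zero]
    positivity
  · have h1 : |f x - f x * radialCutoff k x| ≤ |f x| := by
      rw [← mul_one_sub, abs_mul, abs_of_nonneg (sub_nonneg.2 (radialCutoff_le_one k x))]
      exact mul_le_of_le_one_right (abs_nonneg _) (by linarith [radialCutoff_nonneg k x])
    refine (h1.trans (hf x)).trans ?_
    rw [div_mul_eq_mul_div, le_div_iff₀ hk, pow_succ, ← mul_assoc]
    exact mul_le_mul_of_nonneg_left (by linarith) (by positivity)

section Functional

variable {q : ℕ} {L : growthSubmodule X q →ₗ[ℝ] ℝ}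

lemma map_le_map_of_nonneg (hL : ∀ f, (∀ x, 0 ≤ f.1 x) → 0 ≤ L f)
    {f g : growthSubmodule X q} (h : ∀ x, f.1 x ≤ g.1 x) : L f ≤ L g := by
  have := hL (g - f) fun x => sub_nonneg.2 (h x)
  rwa [map_sub, sub_nonneg] at this

lemma abs_map_le_of_abs_le (hL : ∀ f, (∀ x, 0 ≤ f.1 x) → 0 ≤ L f)
    {f g : growthSubmodule X q} (h : ∀ x, |f.1 x| ≤ g.1 x) : |L f| ≤ L g := by
  refine abs_le'.2 ⟨map_le_map_of_nonneg hL fun x => (le_abs_self _).trans (h x), ?_⟩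
  rw [← map_neg]
  exact map_le_map_of_nonneg hL fun x => (neg_le_abs _).trans (h x)

end Functional

lemma mem_growthSubmodule_of_compactSupport {q : ℕ} (f : C_c(X, ℝ)) :
    (f : X → ℝ) ∈ growthSubmodule X q := by
  obtain ⟨C, hC⟩ := f.hasCompactSupport.exists_bound_of_continuous f.continuous
  exact mem_growthSubmodule_of_bounded hC

/-- A positive linear functional on functions of growth `q` is given on compactly supported
continuous functions by a measure. -/
lemma exists_measure_integral_eq_of_compactSupport [ProperSpace X] [MeasurableSpace X]
    [BorelSpace X] {q : ℕ} (L : growthSubmodule X q →ₗ[ℝ] ℝ)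
    (hL : ∀ f, (∀ x, 0 ≤ f.1 x) → 0 ≤ L f) :
    ∃ m : Measure X, IsFiniteMeasureOnCompacts m ∧
      ∀ f : C_c(X, ℝ), ∫ x, f x ∂m = L ⟨f, mem_growthSubmodule_of_compactSupport f⟩ := by
  let T : C_c(X, ℝ) →ₗ[ℝ] ℝ :=
    { toFun := fun f => L ⟨f, mem_growthSubmodule_of_compactSupport f⟩
      map_add' := fun f g => by
        rw [← map_add]
        rfl
      map_smul' := fun c f => by
        rw [← map_smul]
        rfl }
  let Λ : C_c(X, ℝ) →ₚ[ℝ] ℝ := ⟨T, fun f g h => map_le_map_of_nonneg hL h⟩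
  have := RealRMK.regular_rieszMeasure Λ
  exact ⟨RealRMK.rieszMeasure Λ, inferInstance, RealRMK.integral_rieszMeasure Λ⟩

/-- A normalized positive linear functional on functions of growth `q + 1` is given on continuous
functions of growth `q` by a probability measure. -/
theorem exists_probabilityMeasure_integral_eq [ProperSpace X] [MeasurableSpace X] [BorelSpace X]
    {q : ℕ} (L : growthSubmodule X (q + 1) →ₗ[ℝ] ℝ) (hL : ∀ f, (∀ x, 0 ≤ f.1 x) → 0 ≤ L f)
    (hone : ∀ f, (∀ x, f.1 x = 1) → L f = 1) :
    ∃ m : Measure X, IsProbabilityMeasure m ∧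
      ∀ f : growthSubmodule X (q + 1), f.1 ∈ growthSubmodule X q → Continuous f.1 →
        Integrable f.1 m ∧ ∫ x, f.1 x ∂m = L f := by
  obtain ⟨m, _, hm⟩ := exists_measure_integral_eq_of_compactSupport L hL
  have mem_cut (f : growthSubmodule X (q + 1)) (k : ℕ) :
      (fun x => f.1 x * radialCutoff k x) ∈ growthSubmodule X (q + 1) :=
    mem_growthSubmodule_of_abs_le f.2 (abs_mul_radialCutoff_le f.1 k)
  have cut (f : growthSubmodule X (q + 1)) (hf : Continuous f.1) (k : ℕ) :
      Integrable (fun x => f.1 x * radialCutoff k x) m ∧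
        ∫ x, f.1 x * radialCutoff k x ∂m = L ⟨_, mem_cut f k⟩ := by
    have hc : Continuous fun x => f.1 x * radialCutoff k x := hf.mul (continuous_radialCutoff k)
    have hs : HasCompactSupport fun x => f.1 x * radialCutoff k x :=
      (hasCompactSupport_radialCutoff k).mul_left
    exact ⟨hc.integrable_of_hasCompactSupport hs, hm ⟨⟨_, hc⟩, hs⟩⟩
  have key (f : growthSubmodule X (q + 1)) (hfq : f.1 ∈ growthSubmodule X q)
      (hf : Continuous f.1) : Integrable f.1 m ∧ ∫ x, f.1 x ∂m = L f := by
    let a : growthSubmodule X (q + 1) :=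
      ⟨fun x => |f.1 x|, mem_growthSubmodule_of_abs_le f.2 fun x => (abs_abs _).le⟩
    have hbound (k : ℕ) : ∫⁻ x, ‖f.1 x * radialCutoff k x‖ₑ ∂m ≤ ENNReal.ofReal (L a) := by
      rw [← ofReal_integral_norm_eq_lintegral_enorm (cut f hf k).1]
      refine ENNReal.ofReal_le_ofReal ?_
      have : ∫ x, ‖f.1 x * radialCutoff k x‖ ∂m = ∫ x, a.1 x * radialCutoff k x ∂m := by
        refine integral_congr_ae (.of_forall fun x => ?_)
        simp [a, abs_of_nonneg (radialCutoff_nonneg k x)]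
      rw [this, (cut a hf.abs k).2]
      exact map_le_map_of_nonneg hL fun x =>
        mul_le_of_le_one_right (abs_nonneg _) (radialCutoff_le_one k x)
    have hint : Integrable f.1 m := by
      refine ⟨hf.aestronglyMeasurable, ?_⟩
      calc ∫⁻ x, ‖f.1 x‖ₑ ∂m
          = ∫⁻ x, liminf (fun k : ℕ => ‖f.1 x * radialCutoff k x‖ₑ) atTop ∂m :=
            lintegral_congr fun x => (tendsto_mul_radialCutoff f.1 x).enorm.liminf_eq.symm
        _ ≤ liminf (fun k : ℕ => ∫⁻ x, ‖f.1 x * radialCutoff k x‖ₑ ∂m) atTop :=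
            lintegral_liminf_le' fun k => (cut f hf k).1.1.enorm
        _ ≤ ENNReal.ofReal (L a) := liminf_le_of_le (by isBoundedDefault) fun b hb => by
            obtain ⟨k, hk⟩ := hb.exists
            exact hk.trans (hbound k)
        _ < ⊤ := ENNReal.ofReal_lt_top
    refine ⟨hint, ?_⟩
    have lim1 : Tendsto (fun k : ℕ => ∫ x, f.1 x * radialCutoff k x ∂m) atTop
        (𝓝 (∫ x, f.1 x ∂m)) :=
      tendsto_integral_of_dominated_convergence (fun x => |f.1 x|) (fun k => (cut f hf k).1.1)
        hint.abs (fun k => .of_forall fun x => abs_mul_radialCutoff_le f.1 k x)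
        (.of_forall fun x => tendsto_mul_radialCutoff f.1 x)
    obtain ⟨C, hC⟩ := hfq
    let w : growthSubmodule X (q + 1) := ⟨_, one_add_norm_pow_mem_growthSubmodule (q + 1)⟩
    have lim2 : Tendsto (fun k : ℕ => ∫ x, f.1 x * radialCutoff k x ∂m) atTop (𝓝 (L f)) := by
      rw [tendsto_iff_dist_tendsto_zero]
      have h0 : Tendsto (fun k : ℕ => C / ((k : ℝ) + 1) * L w) atTop (𝓝 0) := by
        have := (tendsto_one_div_add_atTop_nhds_zero_nat (𝕜 := ℝ)).const_mul (C * L w)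
        rw [mul_zero] at this
        exact this.congr fun k => by ring
      refine squeeze_zero (fun _ => dist_nonneg) (fun k => ?_) h0
      rw [dist_comm, Real.dist_eq, (cut f hf k).2, ← map_sub, ← smul_eq_mul, ← map_smul]
      exact abs_map_le_of_abs_le hL (abs_sub_mul_radialCutoff_le hC k)
    exact tendsto_nhds_unique lim1 lim2
  refine ⟨m, ?_, key⟩
  have one_mem (r : ℕ) : (fun _ : X => (1 : ℝ)) ∈ growthSubmodule X r :=
    mem_growthSubmodule_of_bounded (C := 1) fun x => by simp
  obtain ⟨h1, h2⟩ := key ⟨_, one_mem _⟩ (one_mem _) continuous_const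
  rw [hone _ fun _ => rfl] at h2
  have hfin : IsFiniteMeasure m := by
    simpa [integrable_const_iff] using h1
  refine ⟨?_⟩
  have h3 : m.real Set.univ = 1 := by simpa using h2
  exact (ENNReal.toReal_eq_one_iff _).1 h3

end Growth

/-- A sublinear functional on a real vector space is attained at any given point by a dominated
linear functional. -/
lemma exists_linearMap_le_sublinear_eq {E : Type*} [AddCommGroup E] [Module ℝ E] (N : E → ℝ)
    (hsmul : ∀ c : ℝ, 0 ≤ c → ∀ x, N (c • x) = c * N x)
    (hadd : ∀ x y, N (x + y) ≤ N x + N y) (v : E) :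
    ∃ g : E →ₗ[ℝ] ℝ, g v = N v ∧ ∀ x, g x ≤ N x := by
  have hzero : N 0 = 0 := by simpa using hsmul 0 le_rfl 0
  have H (c : ℝ) (hc : c • v = 0) : RingHom.id ℝ c • N v = 0 := by
    rcases smul_eq_zero.1 hc with h | h <;> simp [h, hzero]
  obtain ⟨g, hg, hgN⟩ := exists_extension_of_le_sublinear (LinearPMap.mkSpanSingleton' v (N v) H) N
    (fun c hc => hsmul c hc.le) hadd (by
      rintro ⟨x, hx⟩
      obtain ⟨c, rfl⟩ := Submodule.mem_span_singleton.1 hx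
      rw [LinearPMap.mkSpanSingleton'_apply]
      simp only [RingHom.id_apply, smul_eq_mul]
      rcases le_total 0 c with h | h
      · exact (hsmul c h v).ge
      · have h1 := hadd (c • v) ((-c) • v)
        rw [← add_smul, add_neg_cancel, zero_smul, hzero, hsmul (-c) (by linarith)] at h1
        linarith)
  refine ⟨g, ?_, hgN⟩
  exact (hg ⟨v, Submodule.mem_span_singleton_self v⟩).trans
    (LinearPMap.mkSpanSingleton'_apply_self v (N v) H _)

section CLip

variable {n : ℕ}

/-- `CLip q n` as a linear subspace. -/
def clipSubmodule (q n : ℕ) : Submodule ℝ (EuclideanSpace ℝ (Fin n) → ℝ) where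
  carrier := CLip q n
  zero_mem' := ⟨0, fun x y => by simp⟩
  add_mem' := by
    rintro f g ⟨K, hK⟩ ⟨M, hM⟩
    refine ⟨K + M, fun x y => ?_⟩
    rw [add_mul, add_mul, Pi.add_apply, Pi.add_apply, add_sub_add_comm]
    exact (abs_add_le _ _).trans (add_le_add (hK x y) (hM x y))
  smul_mem' := by
    rintro c f ⟨K, hK⟩
    refine ⟨|c| * K, fun x y => ?_⟩
    rw [Pi.smul_apply, Pi.smul_apply, smul_eq_mul, smul_eq_mul, ← mul_sub, abs_mul, mul_assoc,
      mul_assoc, ← mul_assoc K]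
    exact mul_le_mul_of_nonneg_left (hK x y) (abs_nonneg c)

lemma const_mem_CLip (q : ℕ) (c : ℝ) : (fun _ => c) ∈ CLip q n := ⟨0, fun x y => by simp⟩

lemma continuous_of_mem_CLip {q : ℕ} {f : EuclideanSpace ℝ (Fin n) → ℝ} (hf : f ∈ CLip q n) :
    Continuous f := by
  obtain ⟨K, hK⟩ := hf
  rw [continuous_iff_continuousAt]
  intro y
  rw [ContinuousAt, tendsto_iff_dist_tendsto_zero]
  have h : Tendsto (fun x => K * (1 + ‖x‖ ^ (q - 1) + ‖y‖ ^ (q - 1)) * ‖x - y‖) (𝓝 y) (𝓝 0) := by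
    have hc : Continuous fun x : EuclideanSpace ℝ (Fin n) =>
        K * (1 + ‖x‖ ^ (q - 1) + ‖y‖ ^ (q - 1)) * ‖x - y‖ := by fun_prop
    simpa using hc.tendsto y
  exact squeeze_zero (fun _ => dist_nonneg) (fun x => hK x y) h

lemma CLip_succ_subset_growthSubmodule {q : ℕ} {f : EuclideanSpace ℝ (Fin n) → ℝ}
    (hf : f ∈ CLip (q + 1) n) : f ∈ growthSubmodule (EuclideanSpace ℝ (Fin n)) (q + 1) := by
  obtain ⟨K, hK⟩ := hf
  refine ⟨|f 0| + |K| * 3, fun x => ?_⟩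
  have h := hK x 0
  simp only [Nat.add_sub_cancel, sub_zero, norm_zero] at h
  have hx := norm_nonneg x
  have h1 : (1 : ℝ) ≤ (1 + ‖x‖) ^ q := one_le_pow₀ (by linarith)
  have h2 : ‖x‖ ^ q ≤ (1 + ‖x‖) ^ q := by
    gcongr
    linarith
  have h3 : (0 : ℝ) ^ q ≤ 1 := pow_le_one₀ le_rfl zero_le_one
  have h4 : (1 : ℝ) ≤ (1 + ‖x‖) ^ (q + 1) := one_le_pow₀ (by linarith)
  have h5 : K * (1 + ‖x‖ ^ q + 0 ^ q) * ‖x‖ ≤ |K| * (3 * (1 + ‖x‖) ^ q) * (1 + ‖x‖) := by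
    gcongr
    · exact le_abs_self K
    · linarith
    · linarith
  calc |f x| = |f 0 + (f x - f 0)| := by rw [add_sub_cancel]
    _ ≤ |f 0| + |f x - f 0| := abs_add_le _ _
    _ ≤ |f 0| * (1 + ‖x‖) ^ (q + 1) + |K| * (3 * (1 + ‖x‖) ^ q) * (1 + ‖x‖) :=
        add_le_add (le_mul_of_one_le_right (abs_nonneg _) h4) (h.trans h5)
    _ = (|f 0| + |K| * 3) * (1 + ‖x‖) ^ (q + 1) := by ring

lemma one_add_norm_pow_mem_CLip (q : ℕ) : (fun x => (1 + ‖x‖) ^ (q + 1)) ∈ CLip (q + 1) n := by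
  refine ⟨(q + 1) * 2 ^ q, fun x y => ?_⟩
  simp only [Nat.add_sub_cancel]
  have hpow (t : ℝ) (ht : 0 ≤ t) : (1 + t) ^ q ≤ 2 ^ q * (1 + t ^ q) := by
    have h1 : 1 + t ≤ 2 * max 1 t := by linarith [le_max_left 1 t, le_max_right 1 t]
    refine (pow_le_pow_left₀ (by linarith) h1 q).trans ?_
    rw [mul_pow]
    gcongr
    rcases max_cases 1 t with ⟨h, -⟩ | ⟨h, -⟩ <;> rw [h]
    · rw [one_pow]
      linarith [pow_nonneg ht q]
    · linarith
  have hmax : max |1 + ‖x‖| |1 + ‖y‖| ^ q ≤ 2 ^ q * (1 + ‖x‖ ^ q + ‖y‖ ^ q) := by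
    have hx := norm_nonneg x
    have hy := norm_nonneg y
    rw [abs_of_nonneg (by linarith), abs_of_nonneg (by linarith)]
    have h2 : (0 : ℝ) ≤ 2 ^ q * ‖x‖ ^ q := by positivity
    have h3 : (0 : ℝ) ≤ 2 ^ q * ‖y‖ ^ q := by positivity
    rcases max_cases (1 + ‖x‖) (1 + ‖y‖) with ⟨h, -⟩ | ⟨h, -⟩ <;> rw [h]
    · linarith [hpow _ hx]
    · linarith [hpow _ hy]
  have hsub : |(1 + ‖x‖) - (1 + ‖y‖)| ≤ ‖x - y‖ := by
    rw [add_sub_add_left_eq_sub]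
    exact abs_norm_sub_norm_le x y
  calc |(1 + ‖x‖) ^ (q + 1) - (1 + ‖y‖) ^ (q + 1)|
      ≤ |(1 + ‖x‖) - (1 + ‖y‖)| * ((q + 1 : ℕ) : ℝ) * max |1 + ‖x‖| |1 + ‖y‖| ^ q :=
        abs_pow_sub_pow_le _ _ _
    _ ≤ ‖x - y‖ * ((q + 1 : ℕ) : ℝ) * (2 ^ q * (1 + ‖x‖ ^ q + ‖y‖ ^ q)) := by gcongr
    _ = (q + 1) * 2 ^ q * (1 + ‖x‖ ^ q + ‖y‖ ^ q) * ‖x - y‖ := by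
        push_cast
        ring

lemma CLip_succ_subset_CLip_succ_succ (q : ℕ) : CLip (q + 1) n ⊆ CLip (q + 2) n := by
  rintro f ⟨K, hK⟩
  refine ⟨|K| * 3, fun x y => (hK x y).trans ?_⟩
  have hpow (t : ℝ) (ht : 0 ≤ t) : t ^ q ≤ 1 + t ^ (q + 1) := by
    rcases le_total t 1 with h | h
    · linarith [pow_le_one₀ ht h (n := q), pow_nonneg ht (q + 1)]
    · linarith [pow_le_pow_right₀ h (show q ≤ q + 1 by omega)]
  have hx := hpow _ (norm_nonneg x)
  have hy := hpow _ (norm_nonneg y)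
  have hx' : 0 ≤ ‖x‖ ^ (q + 1) := by positivity
  have hy' : 0 ≤ ‖y‖ ^ (q + 1) := by positivity
  rw [mul_assoc |K|]
  simp only [Nat.add_sub_cancel, show q + 2 - 1 = q + 1 from rfl]
  gcongr
  · exact le_abs_self K
  · linarith

/-- A positive linear functional on `CLip (q + 1) n` extends to a positive linear functional on
all functions of growth `q + 1`. -/
lemma exists_positive_extension_growthSubmodule {q : ℕ} (g : clipSubmodule (q + 1) n →ₗ[ℝ] ℝ)
    (hg : ∀ f, (∀ x, 0 ≤ f.1 x) → 0 ≤ g f) :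
    ∃ L : growthSubmodule (EuclideanSpace ℝ (Fin n)) (q + 1) →ₗ[ℝ] ℝ,
      (∀ f, (∀ x, 0 ≤ f.1 x) → 0 ≤ L f) ∧
      ∀ f : clipSubmodule (q + 1) n,
        L ⟨f.1, CLip_succ_subset_growthSubmodule f.2⟩ = g f := by
  let G := growthSubmodule (EuclideanSpace ℝ (Fin n)) (q + 1)
  let s : PointedCone ℝ G :=
    { carrier := {f | ∀ x, 0 ≤ f.1 x}
      zero_mem' := fun _ => le_rfl
      smul_mem' := fun c f hf x => mul_nonneg c.2 (hf x)
      add_mem' := fun hf hg x => add_nonneg (hf x) (hg x) }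
  let D : G →ₗ.[ℝ] ℝ :=
    { domain := (clipSubmodule (q + 1) n).comap G.subtype
      toFun := g ∘ₗ G.subtype.restrict fun _ h => h }
  obtain ⟨L, hLD, hL⟩ := riesz_extension s D (fun f hf => hg _ hf) (by
    rintro ⟨f, C, hC⟩
    refine ⟨⟨⟨C • fun x => (1 + ‖x‖) ^ (q + 1),
      G.smul_mem C (one_add_norm_pow_mem_growthSubmodule (q + 1))⟩,
      (clipSubmodule (q + 1) n).smul_mem C (one_add_norm_pow_mem_CLip q)⟩, fun x => ?_⟩
    have := (neg_le_abs _).trans (hC x)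
    change 0 ≤ C * (1 + ‖x‖) ^ (q + 1) + f x
    linarith)
  exact ⟨L, hL, fun f => hLD ⟨⟨f.1, CLip_succ_subset_growthSubmodule f.2⟩, f.2⟩⟩

end CLip

/-- a sublinear expectation on `C_{2p,Lip}(ℝ^n)` is represented on
`C_{2p-1,Lip}(ℝ^n)` as the supremum of integrals against a nonempty family of Borel
probability measures. -/
theorem sublinear_expectation_measure_representation
    (n p : ℕ) (hp : 1 ≤ p)
    (Λ : ((EuclideanSpace ℝ (Fin n)) → ℝ) → ℝ)
    (hmono : ∀ f ∈ CLip (2 * p) n, ∀ g ∈ CLip (2 * p) n, (∀ x, g x ≤ f x) → Λ g ≤ Λ f)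
    (hconstpres : ∀ c : ℝ, Λ (fun _ => c) = c)
    (hsubadd : ∀ f ∈ CLip (2 * p) n, ∀ g ∈ CLip (2 * p) n, Λ (f + g) ≤ Λ f + Λ g)
    (hposhom : ∀ f ∈ CLip (2 * p) n, ∀ a : ℝ, 0 ≤ a → Λ (a • f) = a * Λ f) :
    ∃ (Θ : Type) (_ : Nonempty Θ) (m : Θ → Measure (EuclideanSpace ℝ (Fin n))),
      (∀ θ, IsProbabilityMeasure (m θ)) ∧
      (∀ f ∈ CLip (2 * p - 1) n,
        (∀ θ, Integrable f (m θ)) ∧ Λ f = ⨆ θ, ∫ x, f x ∂(m θ)) := by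
  obtain ⟨q, hq⟩ : ∃ q, 2 * p = q + 2 := ⟨2 * p - 2, by omega⟩
  have hq' : 2 * p - 1 = q + 1 := by omega
  rw [hq] at hmono hsubadd hposhom
  rw [hq']
  have exists_measure (v : EuclideanSpace ℝ (Fin n) → ℝ) (hv : v ∈ CLip (q + 2) n) :
      ∃ m : Measure (EuclideanSpace ℝ (Fin n)), IsProbabilityMeasure m ∧
        (∀ f ∈ CLip (q + 1) n, Integrable f m ∧ ∫ x, f x ∂m ≤ Λ f) ∧
        (v ∈ CLip (q + 1) n → ∫ x, v x ∂m = Λ v) := by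
    obtain ⟨g, hgv, hgΛ⟩ := exists_linearMap_le_sublinear_eq
      (fun f : clipSubmodule (q + 2) n => Λ f.1) (fun c hc f => hposhom f.1 f.2 c hc)
      (fun f h => hsubadd f.1 f.2 h.1 h.2) ⟨v, hv⟩
    have hg (f : clipSubmodule (q + 2) n) (hf : ∀ x, 0 ≤ f.1 x) : 0 ≤ g f := by
      have h1 := hgΛ (-f)
      have h2 := hmono _ (const_mem_CLip _ 0) _ (-f).2 fun x => neg_nonpos.2 (hf x)
      rw [hconstpres] at h2
      rw [map_neg] at h1
      linarith
    let c (a : ℝ) : clipSubmodule (q + 2) n := ⟨fun _ => a, const_mem_CLip _ a⟩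
    have hgone : g (c 1) = 1 := by
      have h1 : g (c 1) ≤ Λ fun _ => 1 := hgΛ (c 1)
      have h2 : g (c (-1)) ≤ Λ fun _ => -1 := hgΛ (c (-1))
      have h3 : c (-1) = -c 1 := rfl
      rw [hconstpres] at h1 h2
      rw [h3, map_neg] at h2
      linarith
    obtain ⟨L, hL, hLg⟩ := exists_positive_extension_growthSubmodule g hg
    have hLone (f) (hf : ∀ x, f.1 x = 1) : L f = 1 := by
      rw [← hgone, ← hLg (c 1)]
      congr 1
      exact Subtype.ext (funext hf)
    obtain ⟨m, hm, hmL⟩ := exists_probabilityMeasure_integral_eq L hL hLone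
    have hmg (f) (hf : f ∈ CLip (q + 1) n) : Integrable f m ∧
        ∫ x, f x ∂m = g ⟨f, CLip_succ_subset_CLip_succ_succ q hf⟩ := by
      rw [← hLg]
      exact hmL ⟨f, _⟩ (CLip_succ_subset_growthSubmodule hf) (continuous_of_mem_CLip hf)
    exact ⟨m, hm, fun f hf => ⟨(hmg f hf).1, (hmg f hf).2.trans_le (hgΛ _)⟩,
      fun h => (hmg v h).2.trans hgv⟩
  let Θ := {m : Measure (EuclideanSpace ℝ (Fin n)) // IsProbabilityMeasure m ∧
    ∀ f ∈ CLip (q + 1) n, Integrable f m ∧ ∫ x, f x ∂m ≤ Λ f}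
  have hΘ : Nonempty Θ := by
    obtain ⟨m, h1, h2, -⟩ := exists_measure _ (const_mem_CLip _ 0)
    exact ⟨⟨m, h1, h2⟩⟩
  refine ⟨Θ, hΘ, Subtype.val, fun θ => θ.2.1, fun f hf => ⟨fun θ => (θ.2.2 f hf).1, ?_⟩⟩
  obtain ⟨m, h1, h2, h3⟩ := exists_measure f (CLip_succ_subset_CLip_succ_succ q hf)
  refine le_antisymm ?_ (ciSup_le fun θ => (θ.2.2 f hf).2)
  rw [← h3 hf]
  exact le_ciSup (f := fun θ : Θ => ∫ x, f x ∂θ.1)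
    ⟨Λ f, Set.forall_mem_range.2 fun θ => (θ.2.2 f hf).2⟩ ⟨m, h1, h2⟩
end

section
/- Let p ≥ 1 be an integer, let Λ : C_{2p,Lip}(ℝ^n) → ℝ be a sublinear expectation, and let P̄ denote the set of all Borel probability measures m on ℝ^n such that every f ∈ C_{2p−1,Lip}(ℝ^n) is m-integrable and ∫_{ℝ^n} f dm ≤ Λ[f]. If (m_i) is a sequence in P̄ converging weakly to a Borel probability measure m (i.e., ∫ φ dm_i → ∫ φ dm for every bounded continuous φ : ℝ^n → ℝ), then m ∈ P̄; that is, every f ∈ C_{2p−1,Lip}(ℝ^n) is m-integrable and ∫_{ℝ^n} f dm ≤ Λ[f]. -/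
open MeasureTheory Filter Topology BoundedContinuousFunction

/-- The set `P̄` of Borel probability measures dominated by the sublinear expectation `Λ`
on `C_{2p-1,Lip}(ℝ^n)`. -/
def Pbar (n p : ℕ) (Λ : ((EuclideanSpace ℝ (Fin n)) → ℝ) → ℝ) :
    Set (Measure (EuclideanSpace ℝ (Fin n))) :=
  {m | IsProbabilityMeasure m ∧
    ∀ f ∈ CLip (2 * p - 1) n, Integrable f m ∧ ∫ x, f x ∂m ≤ Λ f}

lemma CLip.exists_nonneg_const {q n : ℕ} {f : EuclideanSpace ℝ (Fin n) → ℝ} (hf : f ∈ CLip q n) :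
    ∃ K : ℝ, 0 ≤ K ∧ ∀ x x' : EuclideanSpace ℝ (Fin n),
      |f x - f x'| ≤ K * (1 + ‖x‖ ^ (q - 1) + ‖x'‖ ^ (q - 1)) * ‖x - x'‖ := by
  obtain ⟨K, hK⟩ := hf
  refine ⟨|K|, abs_nonneg K, fun x x' => (hK x x').trans ?_⟩
  gcongr
  exact le_abs_self K

lemma CLip.add_mem {q n : ℕ} {f g : EuclideanSpace ℝ (Fin n) → ℝ}
    (hf : f ∈ CLip q n) (hg : g ∈ CLip q n) : f + g ∈ CLip q n := by
  obtain ⟨K, hK⟩ := hf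
  obtain ⟨L, hL⟩ := hg
  refine ⟨K + L, fun x x' => ?_⟩
  have h1 : (f + g) x - (f + g) x' = (f x - f x') + (g x - g x') := by
    simp only [Pi.add_apply]; ring
  rw [h1, add_mul, add_mul]
  exact (abs_add_le _ _).trans (add_le_add (hK x x') (hL x x'))

lemma CLip.smul_mem {q n : ℕ} {f : EuclideanSpace ℝ (Fin n) → ℝ}
    (hf : f ∈ CLip q n) (a : ℝ) : a • f ∈ CLip q n := by
  obtain ⟨K, hK⟩ := hf
  refine ⟨|a| * K, fun x x' => ?_⟩
  have h1 : (a • f) x - (a • f) x' = a * (f x - f x') := by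
    simp only [Pi.smul_apply, smul_eq_mul]; ring
  rw [h1, abs_mul, mul_assoc |a|, mul_assoc |a|]
  exact mul_le_mul_of_nonneg_left (hK x x') (abs_nonneg a)

lemma CLip.min_const_mem {q n : ℕ} {f : EuclideanSpace ℝ (Fin n) → ℝ}
    (hf : f ∈ CLip q n) (N : ℝ) : (fun x => min (f x) N) ∈ CLip q n := by
  obtain ⟨K, hK⟩ := hf
  exact ⟨K, fun x x' => (abs_inf_sub_inf_le_abs (f x) (f x') N).trans (hK x x')⟩

lemma CLip.subset_succ (q n : ℕ) : CLip q n ⊆ CLip (q + 1) n := by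
  intro f hf
  obtain ⟨K, hK0, hK⟩ := CLip.exists_nonneg_const hf
  refine ⟨3 * K, fun x x' => (hK x x').trans ?_⟩
  have hpow (t : ℝ) (ht : 0 ≤ t) : t ^ (q - 1) ≤ 1 + t ^ q := by
    rcases le_total t 1 with h | h
    · linarith [pow_le_one₀ (n := q - 1) ht h, pow_nonneg ht q]
    · linarith [pow_le_pow_right₀ h (Nat.sub_le q 1)]
  have hx := hpow _ (norm_nonneg x)
  have hx' := hpow _ (norm_nonneg x')
  have h1 : 0 ≤ ‖x‖ ^ q := by positivity
  have h2 : 0 ≤ ‖x'‖ ^ q := by positivity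
  have h3 : K * (1 + ‖x‖ ^ (q - 1) + ‖x'‖ ^ (q - 1)) ≤
      3 * K * (1 + ‖x‖ ^ (q + 1 - 1) + ‖x'‖ ^ (q + 1 - 1)) := by
    rw [Nat.add_sub_cancel, mul_comm 3 K, mul_assoc K]
    exact mul_le_mul_of_nonneg_left (by linarith) hK0
  exact mul_le_mul_of_nonneg_right h3 (norm_nonneg _)

lemma norm_pow_mem_CLip (q n : ℕ) :
    (fun x : EuclideanSpace ℝ (Fin n) => ‖x‖ ^ q) ∈ CLip q n := by
  refine ⟨q, fun x x' => ?_⟩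
  have h := abs_pow_sub_pow_le ‖x‖ ‖x'‖ q
  rw [abs_norm, abs_norm] at h
  have hmax : max ‖x‖ ‖x'‖ ^ (q - 1) ≤ 1 + ‖x‖ ^ (q - 1) + ‖x'‖ ^ (q - 1) := by
    have h1 : 0 ≤ ‖x‖ ^ (q - 1) := by positivity
    have h2 : 0 ≤ ‖x'‖ ^ (q - 1) := by positivity
    rcases max_choice ‖x‖ ‖x'‖ with h | h <;> rw [h] <;> linarith
  calc |‖x‖ ^ q - ‖x'‖ ^ q| ≤ |‖x‖ - ‖x'‖| * q * max ‖x‖ ‖x'‖ ^ (q - 1) := h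
    _ ≤ ‖x - x'‖ * q * (1 + ‖x‖ ^ (q - 1) + ‖x'‖ ^ (q - 1)) := by
        gcongr
        exact abs_norm_sub_norm_le x x'
    _ = q * (1 + ‖x‖ ^ (q - 1) + ‖x'‖ ^ (q - 1)) * ‖x - x'‖ := by ring

lemma CLip.growth {q n : ℕ} (hq : 1 ≤ q) {f : EuclideanSpace ℝ (Fin n) → ℝ}
    (hf : f ∈ CLip q n) :
    ∃ C : ℝ, 0 ≤ C ∧ ∀ x, |f x| ≤ C * (1 + ‖x‖ ^ q) := by
  obtain ⟨K, hK0, hK⟩ := CLip.exists_nonneg_const hf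
  refine ⟨|f 0| + 3 * K, by positivity, fun x => ?_⟩
  have h := hK x 0
  rw [sub_zero, norm_zero] at h
  have h0 : (0 : ℝ) ^ (q - 1) ≤ 1 := pow_le_one₀ le_rfl zero_le_one
  have hx : ‖x‖ ≤ 1 + ‖x‖ ^ q := by
    rcases le_total ‖x‖ 1 with h | h
    · linarith [pow_nonneg (norm_nonneg x) q]
    · linarith [le_self_pow₀ h (by omega : q ≠ 0)]
  have hpow : ‖x‖ ^ (q - 1) * ‖x‖ = ‖x‖ ^ q := by
    rw [← pow_succ, Nat.sub_add_cancel hq]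
  have hp0 : 0 ≤ ‖x‖ ^ q := by positivity
  have h1 : |f x| ≤ |f 0| + |f x - f 0| := by
    linarith [abs_sub_abs_le_abs_sub (f x) (f 0)]
  have h2 : (1 + ‖x‖ ^ (q - 1) + 0 ^ (q - 1)) * ‖x‖ ≤ 3 * (1 + ‖x‖ ^ q) := by
    have : (0 : ℝ) ^ (q - 1) * ‖x‖ ≤ 1 * ‖x‖ :=
      mul_le_mul_of_nonneg_right h0 (norm_nonneg x)
    nlinarith
  have h3 := mul_le_mul_of_nonneg_left h2 hK0
  have h4 : 0 ≤ |f 0| * ‖x‖ ^ q := by positivity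
  linarith [mul_assoc K (1 + ‖x‖ ^ (q - 1) + 0 ^ (q - 1)) ‖x‖]

lemma CLip.continuous_s7 {q n : ℕ} {f : EuclideanSpace ℝ (Fin n) → ℝ}
    (hf : f ∈ CLip q n) : Continuous f := by
  obtain ⟨K, hK⟩ := hf
  rw [continuous_iff_continuousAt]
  intro x
  rw [ContinuousAt, tendsto_iff_dist_tendsto_zero]
  have hbound : Continuous fun y : EuclideanSpace ℝ (Fin n) =>
      K * (1 + ‖y‖ ^ (q - 1) + ‖x‖ ^ (q - 1)) * ‖y - x‖ := by fun_prop
  refine squeeze_zero (fun _ => dist_nonneg) (fun y => ?_) (hbound.tendsto' x 0 (by simp))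
  rw [Real.dist_eq]
  exact hK y x

/-- A bounded function in some `CLip r n` which is constant outside a ball is globally Lipschitz,
hence belongs to every `CLip q n`. -/
lemma CLip.mem_of_bounded_of_eq_const {r n : ℕ} (q : ℕ) {g : EuclideanSpace ℝ (Fin n) → ℝ}
    (hg : g ∈ CLip r n) {B N R : ℝ} (hB : ∀ x, |g x| ≤ B) (hR : ∀ x, R < ‖x‖ → g x = N) :
    g ∈ CLip q n := by
  obtain ⟨K, hK0, hK⟩ := CLip.exists_nonneg_const hg
  have hB0 : 0 ≤ B := (abs_nonneg _).trans (hB 0)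
  set S : ℝ := |R| + 1
  have hRS : R + 1 ≤ S := by simpa [S] using le_abs_self R
  have hS : 0 ≤ S := by positivity
  set L : ℝ := K * (1 + S ^ (r - 1) + S ^ (r - 1)) + 2 * B
  have hL : 0 ≤ L := by positivity
  have hdiff (x x' : EuclideanSpace ℝ (Fin n)) : |g x - g x'| ≤ 2 * B := by
    linarith [abs_sub (g x) (g x'), hB x, hB x']
  have hfar (x x' : EuclideanSpace ℝ (Fin n)) (h : 1 ≤ ‖x - x'‖) :
      |g x - g x'| ≤ L * ‖x - x'‖ := by
    have h1 : 2 * B ≤ L := by simp only [L]; linarith [show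
      0 ≤ K * (1 + S ^ (r - 1) + S ^ (r - 1)) by positivity]
    nlinarith [hdiff x x']
  have hlip (x x' : EuclideanSpace ℝ (Fin n)) : |g x - g x'| ≤ L * ‖x - x'‖ := by
    by_cases hfx : 1 ≤ ‖x - x'‖
    · exact hfar x x' hfx
    by_cases hout : R < ‖x‖ ∧ R < ‖x'‖
    · rw [hR x hout.1, hR x' hout.2, sub_self, abs_zero]
      positivity
    have hn := abs_le.1 (abs_norm_sub_norm_le x x')
    have hin : ‖x‖ ≤ S ∧ ‖x'‖ ≤ S := by
      rcases not_and_or.1 hout with h | h <;> constructor <;> linarith [hn.1, hn.2]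
    refine (hK x x').trans ?_
    have h1 : K * (1 + ‖x‖ ^ (r - 1) + ‖x'‖ ^ (r - 1)) ≤
        K * (1 + S ^ (r - 1) + S ^ (r - 1)) := by
      gcongr
      · exact hin.1
      · exact hin.2
    exact mul_le_mul_of_nonneg_right (h1.trans (by simp only [L]; linarith)) (norm_nonneg _)
  refine ⟨L, fun x x' => (hlip x x').trans ?_⟩
  have h1 : 1 ≤ 1 + ‖x‖ ^ (q - 1) + ‖x'‖ ^ (q - 1) := by
    linarith [pow_nonneg (norm_nonneg x) (q - 1), pow_nonneg (norm_nonneg x') (q - 1)]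
  exact mul_le_mul_of_nonneg_right (le_mul_of_one_le_right hL h1) (norm_nonneg _)

/-- Adding a multiple of `‖x‖ ^ (q + 1)` to a function of growth order `q` makes it coercive:
its truncations from above are bounded and constant outside a ball. -/
lemma CLip.truncation_bounded_eq_const {q n : ℕ} (hq : 1 ≤ q)
    {f : EuclideanSpace ℝ (Fin n) → ℝ} (hf : f ∈ CLip q n) {ε : ℝ} (hε : 0 < ε) (N : ℝ) :
    ∃ B R : ℝ, (∀ x, |min (f x + ε * ‖x‖ ^ (q + 1)) N| ≤ B) ∧
      ∀ x, R < ‖x‖ → min (f x + ε * ‖x‖ ^ (q + 1)) N = N := by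
  obtain ⟨C, hC0, hC⟩ := CLip.growth hq hf
  set R : ℝ := (2 * C + |N|) / ε + 1
  have hR0 : 1 ≤ R := by
    have : 0 ≤ (2 * C + |N|) / ε := by positivity
    simp only [R]; linarith
  have hconst (x : EuclideanSpace ℝ (Fin n)) (hx : R < ‖x‖) :
      min (f x + ε * ‖x‖ ^ (q + 1)) N = N := by
    apply min_eq_right
    have h1 : 1 ≤ ‖x‖ ^ q := one_le_pow₀ (hR0.trans hx.le)
    have h2 : 2 * C + |N| ≤ ε * ‖x‖ := by
      have : (2 * C + |N|) / ε ≤ ‖x‖ := by simp only [R] at hx; linarith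
      rw [div_le_iff₀ hε] at this
      linarith
    have h3 := (abs_le.1 (hC x)).1
    have h4 := mul_le_mul_of_nonneg_right h2 (zero_le_one.trans h1)
    have h5 : |N| ≤ |N| * ‖x‖ ^ q := le_mul_of_one_le_right (abs_nonneg N) h1
    have h6 : C ≤ C * ‖x‖ ^ q := le_mul_of_one_le_right hC0 h1
    have h7 : ε * ‖x‖ ^ (q + 1) = ε * ‖x‖ * ‖x‖ ^ q := by ring
    rw [h7]
    linarith [le_abs_self N]
  refine ⟨C * (1 + R ^ q) + |N|, R, fun x => ?_, hconst⟩
  have hpos : 0 ≤ C * (1 + R ^ q) := by positivity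
  by_cases hx : R < ‖x‖
  · rw [hconst x hx]; linarith
  · have h1 : C * (1 + ‖x‖ ^ q) ≤ C * (1 + R ^ q) := by
      gcongr
      exact not_lt.1 hx
    have h2 : 0 ≤ ε * ‖x‖ ^ (q + 1) := by positivity
    rw [abs_le]
    constructor
    · apply le_min
      · linarith [(abs_le.1 (hC x)).1, abs_nonneg N]
      · linarith [neg_abs_le N]
    · linarith [min_le_right (f x + ε * ‖x‖ ^ (q + 1)) N, le_abs_self N]

/-- A continuous nonnegative function whose truncations have uniformly bounded integrals is
integrable. -/
lemma integrable_of_integral_min_natCast_le {α : Type*} [TopologicalSpace α] [MeasurableSpace α]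
    [OpensMeasurableSpace α] {m : Measure α} [IsFiniteMeasure m] {h : α → ℝ}
    (hcont : Continuous h) (hnonneg : ∀ x, 0 ≤ h x) {M : ℝ}
    (hM : ∀ k : ℕ, ∫ x, min (h x) k ∂m ≤ M) : Integrable h m := by
  have hmeas : Measurable h := hcont.measurable
  refine ⟨hmeas.aestronglyMeasurable, ?_⟩
  rw [hasFiniteIntegral_iff_ofReal (ae_of_all _ hnonneg)]
  have hnn (k : ℕ) (x : α) : 0 ≤ min (h x) k := le_min (hnonneg x) (Nat.cast_nonneg k)
  have htrunc (k : ℕ) : ∫⁻ x, ENNReal.ofReal (min (h x) k) ∂m ≤ ENNReal.ofReal M := by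
    have hint : Integrable (fun x => min (h x) (k : ℝ)) m := by
      refine Integrable.of_bound (hmeas.min measurable_const).aestronglyMeasurable (k : ℝ)
        (ae_of_all _ fun x => ?_)
      rw [Real.norm_of_nonneg (hnn k x)]
      exact min_le_right _ _
    rw [← ofReal_integral_eq_lintegral_ofReal hint (ae_of_all _ (hnn k))]
    exact ENNReal.ofReal_le_ofReal (hM k)
  have hlim : Tendsto (fun k : ℕ => ∫⁻ x, ENNReal.ofReal (min (h x) k) ∂m) atTop
      (𝓝 (∫⁻ x, ENNReal.ofReal (h x) ∂m)) := by
    refine lintegral_tendsto_of_tendsto_of_monotone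
      (fun k => (hmeas.min measurable_const).ennreal_ofReal.aemeasurable)
      (ae_of_all _ fun x i j hij => ?_) (ae_of_all _ fun x => ?_)
    · exact ENNReal.ofReal_le_ofReal (min_le_min_left _ (Nat.cast_le.2 hij))
    · refine tendsto_const_nhds.congr' ?_
      filter_upwards [eventually_ge_atTop ⌈h x⌉₊] with k hk
      rw [min_eq_left ((Nat.le_ceil _).trans (Nat.cast_le.2 hk))]
  exact (le_of_tendsto' hlim htrunc).trans_lt ENNReal.ofReal_lt_top

lemma tendsto_integral_min_natCast {α : Type*} [MeasurableSpace α] {m : Measure α} {F : α → ℝ}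
    (hF : Integrable F m) :
    Tendsto (fun k : ℕ => ∫ x, min (F x) k ∂m) atTop (𝓝 (∫ x, F x ∂m)) := by
  refine tendsto_integral_of_dominated_convergence (fun x => |F x|)
    (fun k => hF.aestronglyMeasurable.inf aestronglyMeasurable_const) hF.abs
    (fun k => ae_of_all _ fun x => ?_) (ae_of_all _ fun x => ?_)
  · rw [Real.norm_eq_abs, abs_le]
    exact ⟨le_min (neg_abs_le _) ((neg_nonpos.2 (abs_nonneg _)).trans (Nat.cast_nonneg k)),
      (min_le_left _ _).trans (le_abs_self _)⟩
  · refine tendsto_const_nhds.congr' ?_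
    filter_upwards [eventually_ge_atTop ⌈F x⌉₊] with k hk
    rw [min_eq_left ((Nat.le_ceil _).trans (Nat.cast_le.2 hk))]

/-- the set `P̄` is closed under weak convergence of probability measures. -/
theorem Pbar_weakly_closed
    (n p : ℕ) (hp : 1 ≤ p)
    (Λ : ((EuclideanSpace ℝ (Fin n)) → ℝ) → ℝ)
    (hmono : ∀ f ∈ CLip (2 * p) n, ∀ g ∈ CLip (2 * p) n, (∀ x, g x ≤ f x) → Λ g ≤ Λ f)
    (hconstpres : ∀ c : ℝ, Λ (fun _ => c) = c)
    (hsubadd : ∀ f ∈ CLip (2 * p) n, ∀ g ∈ CLip (2 * p) n, Λ (f + g) ≤ Λ f + Λ g)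
    (hposhom : ∀ f ∈ CLip (2 * p) n, ∀ a : ℝ, 0 ≤ a → Λ (a • f) = a * Λ f)
    (ms : ℕ → Measure (EuclideanSpace ℝ (Fin n)))
    (hms : ∀ i, ms i ∈ Pbar n p Λ)
    (m : Measure (EuclideanSpace ℝ (Fin n)))
    (hm : IsProbabilityMeasure m)
    (hweak : ∀ φ : (EuclideanSpace ℝ (Fin n)) →ᵇ ℝ,
      Tendsto (fun i => ∫ x, φ x ∂(ms i)) atTop (𝓝 (∫ x, φ x ∂m))) :
    m ∈ Pbar n p Λ := by
  obtain ⟨q, hq, hpq⟩ : ∃ q, 1 ≤ q ∧ 2 * p = q + 1 := ⟨2 * p - 1, by omega, by omega⟩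
  have hq' : 2 * p - 1 = q := by omega
  simp only [Pbar, Set.mem_ofPred_eq, hq'] at hms ⊢
  rw [hpq] at hmono hsubadd hposhom
  set h : EuclideanSpace ℝ (Fin n) → ℝ := fun x => ‖x‖ ^ (q + 1) with hdef
  have hh : h ∈ CLip (q + 1) n := norm_pow_mem_CLip (q + 1) n
  have hh0 (x : EuclideanSpace ℝ (Fin n)) : 0 ≤ h x := by positivity
  have key : ∀ f ∈ CLip q n, ∀ ε : ℝ, 0 < ε → ∀ N : ℝ,
      ∫ x, min (f x + ε * h x) N ∂m ≤ Λ f + ε * Λ h := by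
    intro f hf ε hε N
    have hf' := CLip.subset_succ q n hf
    have hF : f + ε • h ∈ CLip (q + 1) n := CLip.add_mem hf' (CLip.smul_mem hh ε)
    obtain ⟨B, R, hB, hR⟩ := CLip.truncation_bounded_eq_const hq hf hε N
    have hG : (fun x => min (f x + ε * h x) N) ∈ CLip (q + 1) n := CLip.min_const_mem hF N
    have hGq := CLip.mem_of_bounded_of_eq_const q hG hB hR
    have hΛ : Λ (fun x => min (f x + ε * h x) N) ≤ Λ f + ε * Λ h := by
      refine (hmono _ hF _ hG fun x => min_le_left _ _).trans ?_
      rw [← hposhom h hh ε hε.le]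
      exact hsubadd f hf' _ (CLip.smul_mem hh ε)
    exact le_of_tendsto'
      (hweak (BoundedContinuousFunction.ofNormedAddCommGroup _ (CLip.continuous_s7 hG) B hB))
      fun i => ((hms i).2 _ hGq).2.trans hΛ
  have hint : Integrable h m := by
    refine integrable_of_integral_min_natCast_le (CLip.continuous_s7 hh) hh0
      (M := Λ (fun _ => 0) + 1 * Λ h) fun k => ?_
    have hzero : (fun _ => 0) ∈ CLip q n := ⟨0, fun x x' => by simp⟩
    simpa using key _ hzero 1 one_pos k
  refine ⟨hm, fun f hf => ?_⟩
  have hfint : Integrable f m := by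
    obtain ⟨C, hC0, hC⟩ := CLip.growth hq hf
    refine Integrable.mono' (((integrable_const (2 : ℝ)).add hint).const_mul C)
      (CLip.continuous_s7 hf).aestronglyMeasurable (ae_of_all _ fun x => (hC x).trans ?_)
    refine mul_le_mul_of_nonneg_left ?_ hC0
    simp only [Pi.add_apply, hdef]
    rcases le_total ‖x‖ 1 with hx | hx
    · linarith [pow_le_one₀ (n := q) (norm_nonneg x) hx, pow_nonneg (norm_nonneg x) (q + 1)]
    · linarith [pow_le_pow_right₀ hx (Nat.le_add_right q 1)]
  refine ⟨hfint, ?_⟩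
  have hε (ε : ℝ) (hε : 0 < ε) : ∫ x, f x ∂m ≤ Λ f + ε * Λ h := by
    have hle := le_of_tendsto' (tendsto_integral_min_natCast (hfint.add (hint.const_mul ε)))
      fun k => key f hf ε hε k
    simp only [Pi.add_apply] at hle
    rw [integral_add hfint (hint.const_mul ε), integral_const_mul] at hle
    have : 0 ≤ ε * ∫ x, h x ∂m := mul_nonneg hε.le (integral_nonneg hh0)
    linarith
  have hlim : Tendsto (fun ε : ℝ => Λ f + ε * Λ h) (𝓝[>] 0) (𝓝 (Λ f)) := by
    have hcont : Continuous fun ε : ℝ => Λ f + ε * Λ h := by fun_prop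
    exact (hcont.tendsto' 0 (Λ f) (by simp)).mono_left nhdsWithin_le_nhds
  refine ge_of_tendsto hlim ?_
  filter_upwards [self_mem_nhdsWithin] with ε hpos
  exact hε ε hpos
end

section
/- Let 0 < σ < 1, g₁(x) = x⁴ − 3/4 and g₂(x) = x⁴ + 3(σ² − 1)x² + (3/4)σ⁴ − (3/2)σ². Then ∫_ℝ max(g₁, g₂)(z) γ_{1/2}(dz) ≥ (9/16)(1 − σ²)² · γ_{1/2}({z : |z| ≤ √(1 − σ²)/4}) > 0. -/
open MeasureTheory ProbabilityTheory
open scoped NNReal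

lemma deriv_mul_exp_mul_sq_div_two {p : ℝ → ℝ} {p' v t : ℝ} (hp : HasDerivAt p p' t) :
    deriv (fun s ↦ p s * Real.exp (v * s ^ 2 / 2)) t
      = (p' + p t * (v * t)) * Real.exp (v * t ^ 2 / 2) := by
  have h : HasDerivAt (fun s : ℝ ↦ v * s ^ 2 / 2) (v * t) t := by
    convert! (((hasDerivAt_id t).pow 2).const_mul v).div_const 2 using 1
    simp
    ring
  rw [(hp.fun_mul h.exp).deriv]
  ring

/-- The fourth moment of a centered Gaussian of variance `v` is `3 * v ^ 2`. -/
lemma integral_pow_four_gaussianReal_zero (v : ℝ≥0) :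
    ∫ x, x ^ 4 ∂(gaussianReal 0 v) = 3 * (v : ℝ) ^ 2 := by
  have h := iteratedDeriv_mgf_zero (X := id) (μ := gaussianReal 0 v)
    (by simp [integrableExpSet_id_gaussianReal]) 4
  have d₁ : deriv (fun t : ℝ ↦ Real.exp (v * t ^ 2 / 2))
      = fun t ↦ (v * t) * Real.exp (v * t ^ 2 / 2) := by
    ext t
    simpa using deriv_mul_exp_mul_sq_div_two (v := v) (hasDerivAt_const t (1 : ℝ))
  have d₂ : deriv (fun t : ℝ ↦ (v * t) * Real.exp (v * t ^ 2 / 2))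
      = fun t ↦ (v + v ^ 2 * t ^ 2) * Real.exp (v * t ^ 2 / 2) := by
    ext t
    rw [deriv_mul_exp_mul_sq_div_two ((hasDerivAt_id' t).const_mul (v : ℝ))]
    ring
  have d₃ : deriv (fun t : ℝ ↦ (v + v ^ 2 * t ^ 2) * Real.exp (v * t ^ 2 / 2))
      = fun t ↦ (3 * v ^ 2 * t + v ^ 3 * t ^ 3) * Real.exp (v * t ^ 2 / 2) := by
    ext t
    rw [deriv_mul_exp_mul_sq_div_two
      (((hasDerivAt_pow 2 t).const_mul ((v : ℝ) ^ 2)).const_add (v : ℝ))]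
    push_cast
    ring
  have d₄ : deriv (fun t : ℝ ↦ (3 * v ^ 2 * t + v ^ 3 * t ^ 3) * Real.exp (v * t ^ 2 / 2)) 0
      = 3 * (v : ℝ) ^ 2 := by
    rw [deriv_mul_exp_mul_sq_div_two (((hasDerivAt_id' 0).const_mul (3 * (v : ℝ) ^ 2)).fun_add
      ((hasDerivAt_pow 3 0).const_mul ((v : ℝ) ^ 3)))]
    simp
  simp only [mgf_id_gaussianReal, zero_mul, zero_add, iteratedDeriv_succ, iteratedDeriv_zero,
    d₁, d₂, d₃, d₄] at h
  simpa using h.symm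

lemma integrable_pow_gaussianReal (μ : ℝ) (v : ℝ≥0) (n : ℕ) :
    Integrable (fun x ↦ x ^ n) (gaussianReal μ v) := by
  refine (integrable_norm_iff (by fun_prop)).mp ?_
  simpa using (memLp_id_gaussianReal' (μ := μ) (v := v) n (by simp)).integrable_norm_pow'

/-- for `0 < σ < 1`, with `g₁(x) = x⁴ − 3/4` and
`g₂(x) = x⁴ + 3(σ² − 1)x² + (3/4)σ⁴ − (3/2)σ²`,
`∫ max(g₁, g₂) dγ_{1/2} ≥ (9/16)(1 − σ²)² · γ_{1/2}({|z| ≤ √(1 − σ²)/4}) > 0`. -/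
theorem integral_max_quartic_gaussian_pos (σ : ℝ) (hσ0 : 0 < σ) (hσ1 : σ < 1)
    (g₁ g₂ : ℝ → ℝ)
    (hg₁ : ∀ x, g₁ x = x ^ 4 - 3 / 4)
    (hg₂ : ∀ x, g₂ x = x ^ 4 + 3 * (σ ^ 2 - 1) * x ^ 2 + (3 / 4) * σ ^ 4 - (3 / 2) * σ ^ 2) :
    (9 / 16) * (1 - σ ^ 2) ^ 2 *
        ((gaussianReal 0 (1 / 2)) {z : ℝ | |z| ≤ Real.sqrt (1 - σ ^ 2) / 4}).toReal
      ≤ ∫ z, max (g₁ z) (g₂ z) ∂(gaussianReal 0 (1 / 2)) ∧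
    0 < (9 / 16) * (1 - σ ^ 2) ^ 2 *
        ((gaussianReal 0 (1 / 2)) {z : ℝ | |z| ≤ Real.sqrt (1 - σ ^ 2) / 4}).toReal := by
  have hs : 0 < 1 - σ ^ 2 := by nlinarith
  set γ := gaussianReal 0 (1 / 2)
  set c := (9 / 16) * (1 - σ ^ 2) ^ 2 with hc
  set A := {z : ℝ | |z| ≤ Real.sqrt (1 - σ ^ 2) / 4} with hA
  have hc_pos : 0 < c := by positivity
  have hA_meas : MeasurableSet A := measurableSet_le (by fun_prop) (by fun_prop)
  have hA_pos : 0 < γ A := by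
    refine pos_iff_ne_zero.mpr fun h ↦ ?_
    have hvol : volume A = 0 := gaussianReal_absolutelyContinuous' 0 (by simp) h
    have hball : Metric.closedBall (0 : ℝ) (Real.sqrt (1 - σ ^ 2) / 4) = A := by
      ext z
      simp [hA]
    exact (Metric.measure_closedBall_pos volume (0 : ℝ) (by positivity)).ne' (hball ▸ hvol)
  refine ⟨?_, mul_pos hc_pos (ENNReal.toReal_pos hA_pos.ne' (measure_ne_top _ _))⟩
  have hg₁_int : Integrable g₁ γ := by
    rw [funext hg₁]
    exact (integrable_pow_gaussianReal 0 _ 4).sub (integrable_const _)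
  have hg₂_int : Integrable g₂ γ := by
    rw [funext hg₂]
    exact (((integrable_pow_gaussianReal 0 _ 4).add
      ((integrable_pow_gaussianReal 0 _ 2).const_mul _)).add (integrable_const _)).sub
      (integrable_const _)
  have hg₁_zero : ∫ z, g₁ z ∂γ = 0 := by
    simp_rw [hg₁]
    rw [integral_sub (integrable_pow_gaussianReal 0 _ 4) (integrable_const _),
      integral_pow_four_gaussianReal_zero]
    norm_num
  have hind_int : Integrable (A.indicator fun _ ↦ c) γ := (integrable_const c).indicator hA_meas
  calc c * (γ A).toReal = ∫ z, g₁ z + A.indicator (fun _ ↦ c) z ∂γ := by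
        rw [integral_add hg₁_int hind_int, hg₁_zero, integral_indicator_const c hA_meas]
        simp [Measure.real, mul_comm]
    _ ≤ ∫ z, max (g₁ z) (g₂ z) ∂γ := by
        refine integral_mono (hg₁_int.add hind_int) (hg₁_int.sup hg₂_int) fun z ↦ ?_
        by_cases hz : z ∈ A
        · refine le_trans ?_ (le_max_right _ _)
          have hz_sq : z ^ 2 ≤ (1 - σ ^ 2) / 16 := by
            calc z ^ 2 = |z| ^ 2 := (sq_abs z).symm
              _ ≤ (Real.sqrt (1 - σ ^ 2) / 4) ^ 2 := by gcongr; exact hz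
              _ = (1 - σ ^ 2) / 16 := by rw [div_pow, Real.sq_sqrt hs.le]; norm_num
          simp only [Set.indicator_of_mem hz, hg₁, hg₂, hc]
          nlinarith [mul_le_mul_of_nonneg_left hz_sq hs.le]
        · simp [Set.indicator_of_notMem hz]
end
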